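/- (Theorem 1: interconnection of two ensembles with affine agents, linear controllers and filters.) Let d₁, …, d₆ be natural numbers with d = d₁ + ⋯ + d₆, and let 𝒜 be a d×d real matrix that is block lower triangular with respect to this decomposition, with diagonal blocks D₁, …, D₆, where D₁ and D₂ are block diagonal matrices built from the agent matrices A_i¹ (i = 1,…,N₁) and A_i² (i = 1,…,N₂) respectively, D₃ = A_f¹, D₄ = A_f² (the filter matrices), D₅ = A_c¹, D₆ = A_c² (the controller matrices), and every one of the matrices A_i¹, A_i², A_f¹, A_f², A_c¹, A_c² is Schur. Let β₁, …, β_L ∈ ℝ^d and define W_ℓ(ξ) = 𝒜ξ + β_ℓ. Let p₁, …, p_L : ℝ^d → [0,1] be Dini continuous probability functions with Σ_ℓ p_ℓ(x) = 1 and p_ℓ(x) ≥ δ for some δ > 0 and all x. Then the Markov kernel κ(x) = Σ_ℓ p_ℓ(x)·δ_{W_ℓ(x)} admits a unique invariant Borel probability measure, and this measure is attractive. -/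

import Mathlib

open MeasureTheory Filter Topology

noncomputable section

/-- A real square matrix is Schur if every complex eigenvalue has modulus `< 1`. -/
def IsSchur {ι : Type*} [Fintype ι] [DecidableEq ι] (A : Matrix ι ι ℝ) : Prop :=
  ∀ z ∈ spectrum ℂ (A.map (fun x : ℝ => (x : ℂ))), ‖z‖ < 1

/-- `p` is Dini continuous: `|p x - p y| ≤ φ (dist x y)` for a nondecreasing modulus `φ` with
`φ 0 = 0` and `∫₀¹ φ t / t dt < ∞`. -/
def DiniContinuous {X : Type*} [PseudoMetricSpace X] (p : X → ℝ) : Prop :=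
  ∃ φ : ℝ → ℝ, MonotoneOn φ (Set.Ici 0) ∧ φ 0 = 0 ∧
    IntervalIntegrable (fun t => φ t / t) volume 0 1 ∧
    ∀ x y, |p x - p y| ≤ φ (dist x y)

/-- The Markov kernel `κ x = ∑ ℓ, p ℓ x • δ_{W ℓ x}` of an iterated random function given by
maps `W ℓ` chosen with place-dependent probabilities `p ℓ`. -/
def IFSKernel {X : Type*} [MeasurableSpace X] {L : ℕ}
    (p : Fin L → X → ℝ) (W : Fin L → X → X) (x : X) : Measure X :=
  ∑ ℓ, ENNReal.ofReal (p ℓ x) • Measure.dirac (W ℓ x)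

/-- A measure `μ` is invariant for the kernel `κ` if `μ.bind κ = μ`. -/
def Invariant {X : Type*} [MeasurableSpace X] (κ : X → Measure X) (μ : Measure X) : Prop :=
  μ.bind κ = μ

/-- A measure `μ` is attractive for the kernel `κ` if for every Borel probability measure `ν`,
the iterates `ν, ν.bind κ, (ν.bind κ).bind κ, …` converge weakly to `μ`. -/
def Attractive {X : Type*} [MeasurableSpace X] [TopologicalSpace X]
    (κ : X → Measure X) (μ : Measure X) : Prop :=
  ∀ ν : Measure X, IsProbabilityMeasure ν →
    ∀ f : BoundedContinuousFunction X ℝ,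
      Tendsto (fun k => ∫ x, f x ∂((fun m : Measure X => m.bind κ)^[k] ν))
        atTop (𝓝 (∫ x, f x ∂μ))

/-- The index set of the augmented state in Theorem 1: states of the `N₁` agents on side 1
(agent `i` having dimension `n₁ i`), the `N₂` agents on side 2, the two filters and the two
controllers. -/
abbrev Idx6 (N₁ N₂ : ℕ) (n₁ : Fin N₁ → ℕ) (n₂ : Fin N₂ → ℕ) (d₃ d₄ d₅ d₆ : ℕ) : Type :=
  ((i : Fin N₁) × Fin (n₁ i)) ⊕ (((i : Fin N₂) × Fin (n₂ i)) ⊕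
    (Fin d₃ ⊕ (Fin d₄ ⊕ (Fin d₅ ⊕ Fin d₆))))

/-- The block an index belongs to, for the six-block decomposition. -/
def blk6 {N₁ N₂ : ℕ} {n₁ : Fin N₁ → ℕ} {n₂ : Fin N₂ → ℕ} {d₃ d₄ d₅ d₆ : ℕ} :
    Idx6 N₁ N₂ n₁ n₂ d₃ d₄ d₅ d₆ → ℕ :=
  Sum.elim (fun _ => 0) (Sum.elim (fun _ => 1) (Sum.elim (fun _ => 2)
    (Sum.elim (fun _ => 3) (Sum.elim (fun _ => 4) (fun _ => 5)))))


lemma schur_fromBlocks {m n : Type*} [Fintype m] [Fintype n] [DecidableEq m] [DecidableEq n]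
    (A : Matrix (m ⊕ n) (m ⊕ n) ℝ) (h12 : ∀ i j, A (Sum.inl i) (Sum.inr j) = 0)
    (h1 : IsSchur (A.toBlocks₁₁)) (h2 : IsSchur A.toBlocks₂₂) : IsSchur A := by
  intro z hz
  have hA : A.map (fun x : ℝ => (x : ℂ)) = Matrix.fromBlocks (A.toBlocks₁₁.map (fun x : ℝ => (x : ℂ))) 0
      (A.toBlocks₂₁.map (fun x : ℝ => (x : ℂ))) (A.toBlocks₂₂.map (fun x : ℝ => (x : ℂ))) := by
    ext i j
    rcases i with i | i <;> rcases j with j | j <;>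
      simp [Matrix.toBlocks₁₁, Matrix.toBlocks₂₁, Matrix.toBlocks₂₂, h12]
  rw [Matrix.mem_spectrum_iff_isRoot_charpoly, hA, Matrix.charpoly_fromBlocks_zero₁₂,
    Polynomial.IsRoot, Polynomial.eval_mul, mul_eq_zero] at hz
  rcases hz with hz | hz
  · exact h1 z (Matrix.mem_spectrum_iff_isRoot_charpoly.2 hz)
  · exact h2 z (Matrix.mem_spectrum_iff_isRoot_charpoly.2 hz)

lemma schur_blockDiagonal {N : ℕ} {n : Fin N → ℕ}
    (A : ∀ i : Fin N, Matrix (Fin (n i)) (Fin (n i)) ℝ) (h : ∀ i, IsSchur (A i)) :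
    IsSchur (Matrix.blockDiagonal' A) := by
  intro z hz
  by_contra hcon
  apply hz
  have hu : ∀ i, IsUnit (algebraMap ℂ (Matrix (Fin (n i)) (Fin (n i)) ℂ) z
      - (A i).map (fun x : ℝ => (x : ℂ))) := by
    intro i
    by_contra hi
    exact hcon (h i z hi)
  have hu' := (Pi.isUnit_iff.2 hu : IsUnit (fun i => algebraMap ℂ (Matrix (Fin (n i)) (Fin (n i)) ℂ) z
      - (A i).map (fun x : ℝ => (x : ℂ))))
  have this : IsUnit (Matrix.blockDiagonal' (fun i => algebraMap ℂ (Matrix (Fin (n i)) (Fin (n i)) ℂ) z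
      - (A i).map (fun x : ℝ => (x : ℂ)))) := hu'.map (Matrix.blockDiagonal'RingHom (fun i => Fin (n i)) ℂ)
  rw [spectrum.mem_resolventSet_iff]
  convert this using 1
  ext a b
  rcases a with ⟨i, a⟩
  rcases b with ⟨j, b⟩
  simp only [Matrix.blockDiagonal'_apply, Matrix.sub_apply, Matrix.map_apply,
    Matrix.algebraMap_matrix_apply]
  by_cases hij : i = j
  · subst hij
    simp [Matrix.algebraMap_matrix_apply]
  · simp [hij]

lemma schur_pow_bound {ι : Type*} [Fintype ι] [DecidableEq ι] (A : Matrix ι ι ℝ) (h : IsSchur A) :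
    ∃ C r : ℝ, 0 ≤ C ∧ 0 < r ∧ r < 1 ∧ ∀ n i j, |(A ^ n) i j| ≤ C * r ^ n := by
  classical
  let _ : NormedRing (Matrix ι ι ℂ) := Matrix.linftyOpNormedRing
  let _ : NormedAlgebra ℂ (Matrix ι ι ℂ) := Matrix.linftyOpNormedAlgebra
  have _ : CompleteSpace (Matrix ι ι ℂ) := FiniteDimensional.complete ℂ _
  rcases isEmpty_or_nonempty ι with he | he
  · exact ⟨0, 1/2, le_rfl, by norm_num, by norm_num, fun n i => he.elim i⟩
  set a : Matrix ι ι ℂ := A.map (fun x : ℝ => (x : ℂ)) with ha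
  have hlt : spectralRadius ℂ a < (1 : NNReal) :=
    spectrum.spectralRadius_lt_of_forall_lt a (fun k hk => h k hk)
  obtain ⟨r, hr0, hr1⟩ := ENNReal.lt_iff_exists_nnreal_btwn.1 hlt
  have hr1' : r < 1 := by exact_mod_cast hr1
  have hrpos : 0 < r := by
    have := lt_of_le_of_lt (zero_le) hr0
    exact_mod_cast this
  have hev := (spectrum.pow_nnnorm_pow_one_div_tendsto_nhds_spectralRadius a).eventually
    (gt_mem_nhds hr0)
  have hev2 : ∀ᶠ n : ℕ in atTop, ‖a ^ n‖ ≤ 1 * ‖(r:ℝ) ^ n‖ := by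
    filter_upwards [hev, eventually_gt_atTop 0] with n hn hn0
    have h1 : ((‖a ^ n‖₊ : ENNReal) ^ (1 / n : ℝ)) ^ (n : ℝ) ≤ (r : ENNReal) ^ (n : ℝ) :=
      ENNReal.rpow_le_rpow hn.le (by positivity)
    rw [← ENNReal.rpow_mul, one_div, inv_mul_cancel₀ (by positivity), ENNReal.rpow_one,
      ENNReal.rpow_natCast] at h1
    have h2 : ‖a ^ n‖₊ ≤ r ^ n := by exact_mod_cast h1
    have h3 : ‖a ^ n‖ ≤ (r:ℝ) ^ n := by exact_mod_cast h2
    rw [one_mul, Real.norm_of_nonneg (by positivity)]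
    exact h3
  obtain ⟨N, hN⟩ := eventually_atTop.1 hev2
  have hmap : ∀ n, a ^ n = (A ^ n).map (fun x : ℝ => (x : ℂ)) := by
    intro n
    exact (Matrix.map_pow A Complex.ofRealHom n).symm
  have hent : ∀ n i j, |(A ^ n) i j| ≤ ‖a ^ n‖ := by
    intro n i j
    have h1 : ‖(a ^ n) i j‖ ≤ ‖a ^ n‖ := by
      rw [Matrix.linfty_opNorm_def]
      have h2 : ‖(a ^ n) i j‖₊ ≤ ∑ j, ‖(a ^ n) i j‖₊ :=
        Finset.single_le_sum (f := fun j => ‖(a ^ n) i j‖₊) (fun _ _ => zero_le) (Finset.mem_univ j)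
      have h3 : (∑ j, ‖(a ^ n) i j‖₊) ≤ Finset.univ.sup fun i => ∑ j, ‖(a ^ n) i j‖₊ :=
        Finset.le_sup (f := fun i => ∑ j, ‖(a ^ n) i j‖₊) (Finset.mem_univ i)
      exact_mod_cast h2.trans h3
    rw [hmap n] at h1 ⊢
    simpa using h1
  set C : ℝ := 1 + ∑ k ∈ Finset.range N, ‖a ^ k‖ / (r:ℝ) ^ k with hC
  have hs : 0 ≤ ∑ k ∈ Finset.range N, ‖a ^ k‖ / (r:ℝ) ^ k :=
    Finset.sum_nonneg fun k _ => by positivity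
  refine ⟨C, r, by positivity, by exact_mod_cast hrpos, by exact_mod_cast hr1', fun n i j => ?_⟩
  refine (hent n i j).trans ?_
  have hrn : (0:ℝ) < (r:ℝ) ^ n := by positivity
  by_cases hn : N ≤ n
  · have := hN n hn
    rw [Real.norm_of_nonneg hrn.le] at this
    refine this.trans (mul_le_mul_of_nonneg_right ?_ hrn.le)
    linarith
  · have h1 : ‖a ^ n‖ / (r:ℝ) ^ n ≤ ∑ k ∈ Finset.range N, ‖a ^ k‖ / (r:ℝ) ^ k :=
      Finset.single_le_sum (f := fun k => ‖a ^ k‖ / (r:ℝ) ^ k) (fun _ _ => by positivity)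
        (Finset.mem_range.2 (not_le.1 hn))
    rw [div_le_iff₀ hrn] at h1
    nlinarith

lemma schur_clm_bound {ι : Type*} [Fintype ι] [DecidableEq ι] (A : Matrix ι ι ℝ) (h : IsSchur A) :
    ∃ C r : ℝ, 0 ≤ C ∧ 0 < r ∧ r < 1 ∧
      ∀ n (x : EuclideanSpace ℝ ι), ‖((Matrix.toEuclideanLin A)^[n]) x‖ ≤ C * r ^ n * ‖x‖ := by
  obtain ⟨C, r, hC, hr0, hr1, hb⟩ := schur_pow_bound A h
  refine ⟨Fintype.card ι * (Fintype.card ι * C), r, by positivity, hr0, hr1, fun n x => ?_⟩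
  have hit : ((Matrix.toEuclideanLin A)^[n]) x = WithLp.toLp 2 ((A ^ n).mulVec x.ofLp) := by
    induction n with
    | zero => simp
    | succ n ih =>
      rw [Function.iterate_succ_apply', ih, pow_succ', ← Matrix.mulVec_mulVec]
      rfl
  rw [hit]
  have hnorm : ∀ y : EuclideanSpace ℝ ι, ‖y‖ ≤ ∑ i, |y i| := by
    intro y
    rw [EuclideanSpace.norm_eq]
    apply Real.sqrt_le_iff.2
    refine ⟨Finset.sum_nonneg fun i _ => abs_nonneg _, ?_⟩
    exact Finset.sum_sq_le_sq_sum_of_nonneg (fun i _ => abs_nonneg _)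
  refine (hnorm _).trans ?_
  have hi : ∀ i, |((A ^ n).mulVec x.ofLp) i| ≤ Fintype.card ι * C * r ^ n * ‖x‖ := by
    intro i
    unfold Matrix.mulVec dotProduct
    refine (Finset.abs_sum_le_sum_abs _ _).trans ?_
    calc _ ≤ ∑ j : ι, C * r ^ n * ‖x‖ := by
          refine Finset.sum_le_sum fun j _ => ?_
          rw [abs_mul]
          have := PiLp.norm_apply_le x j
          rw [Real.norm_eq_abs] at this
          exact mul_le_mul (hb n i j) this (abs_nonneg _) (by positivity)
      _ = _ := by simp; ring
  calc _ ≤ ∑ i : ι, Fintype.card ι * C * r ^ n * ‖x‖ := Finset.sum_le_sum fun i _ => hi i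
    _ = _ := by simp; ring

lemma real_key (w : ℕ → ℕ → ℝ) (q : ℕ → ℝ) (K : ℝ) (h0 : ∀ n k, 0 ≤ w n k) (hK : ∀ n k, w n k ≤ K)
    (hmono : ∀ n k, w n (k + 1) ≤ w n k) (hq0 : ∀ k, 0 ≤ q k) (hq1 : ∀ k, q k < 1)
    (hs : Summable q)
    (hrec : ∀ n k, w (n + 1) k ≤ (1 - q k) * w n (k + 1) + q k * w n 0)
    (hw0 : Tendsto (w 0) atTop (𝓝 0)) : Tendsto (fun n => w n 0) atTop (𝓝 0) := by
  have hK0 : 0 ≤ K := (h0 0 0).trans (hK 0 0)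
  have hanti : Antitone (fun n => w n 0) := by
    refine antitone_nat_of_succ_le fun n => ?_
    have := hrec n 0
    nlinarith [hmono n 0, hq0 0, hq1 0]
  have hlim := tendsto_atTop_ciInf hanti ⟨0, by rintro _ ⟨n, rfl⟩; exact h0 n 0⟩
  set a := ⨅ n, w n 0
  have ha0 : 0 ≤ a := ge_of_tendsto' hlim fun n => h0 n 0
  have h1 : ∀ n k, w n k ≤ w 0 (n + k) + K * ∑ j ∈ Finset.range n, q (j + k) := by
    intro n
    induction n with
    | zero => intro k; simp
    | succ n ih =>
      intro k
      rw [Finset.sum_range_succ']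
      have e1 := ih (k + 1)
      have e2 := hrec n k
      have e3 : ∑ j ∈ Finset.range n, q (j + (k + 1)) = ∑ j ∈ Finset.range n, q (j + 1 + k) :=
        Finset.sum_congr rfl fun j _ => by congr 1; ring
      have e4 : n + (k + 1) = n + 1 + k := by ring
      rw [e3, e4] at e1
      simp only [zero_add]
      nlinarith [h0 n (k+1), hK n 0, hq0 k, mul_nonneg (hq0 k) (h0 n (k+1)),
        mul_le_mul_of_nonneg_left (hK n 0) (hq0 k)]
  have hanti0 : Antitone (w 0) := antitone_nat_of_succ_le (hmono 0)
  have h2 : ∀ n k, w n k ≤ w 0 k + K * ∑' j, q (j + k) := by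
    intro n k
    refine (h1 n k).trans (add_le_add (hanti0 (by omega)) (mul_le_mul_of_nonneg_left ?_ hK0))
    exact ((summable_nat_add_iff k).2 hs).sum_le_tsum _ (fun j _ => hq0 _)
  have h3 : ∀ k, ∃ P : ℝ, 0 < P ∧ P ≤ 1 ∧ ∀ n, w (n + k) 0 ≤ P * w n k + (1 - P) * w n 0 := by
    intro k
    induction k with
    | zero => exact ⟨1, one_pos, le_rfl, fun n => by simp⟩
    | succ k ih =>
      obtain ⟨P, hP0, hP1, hP⟩ := ih
      refine ⟨P * (1 - q k), mul_pos hP0 (by linarith [hq1 k]), ?_, fun n => ?_⟩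
      · nlinarith [hq0 k]
      · have e1 := hP (n + 1)
        have e4 : n + (k + 1) = n + 1 + k := by ring
        rw [e4]
        have e2 := mul_le_mul_of_nonneg_left (hrec n k) hP0.le
        have e3 := mul_le_mul_of_nonneg_left (hanti (Nat.le_succ n)) (sub_nonneg.2 hP1)
        simp only [Nat.succ_eq_add_one] at e3
        linarith
  have h4 : ∀ k, a ≤ w 0 k + K * ∑' j, q (j + k) := by
    intro k
    obtain ⟨P, hP0, hP1, hP⟩ := h3 k
    have l1 : Tendsto (fun n => w (n + k) 0) atTop (𝓝 a) := (tendsto_add_atTop_iff_nat k).2 hlim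
    have l2 : Tendsto (fun n => P * (w 0 k + K * ∑' j, q (j + k)) + (1 - P) * w n 0) atTop
        (𝓝 (P * (w 0 k + K * ∑' j, q (j + k)) + (1 - P) * a)) :=
      (hlim.const_mul _).const_add _
    have := le_of_tendsto_of_tendsto' l1 l2 fun n => (hP n).trans
      (by gcongr; exact h2 n k)
    nlinarith
  have h5 : Tendsto (fun k => w 0 k + K * ∑' j, q (j + k)) atTop (𝓝 (0 + K * 0)) :=
    hw0.add ((tendsto_sum_nat_add q).const_mul K)
  have h6 : a ≤ 0 := by
    have := ge_of_tendsto' h5 h4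
    simpa using this
  have : a = 0 := le_antisymm h6 ha0
  rwa [this] at hlim

lemma dini_summable (φ : ℝ → ℝ) (hm : MonotoneOn φ (Set.Ici 0)) (h0 : φ 0 = 0)
    (hi : IntervalIntegrable (fun t => φ t / t) volume 0 1) (r M : ℝ) (hr0 : 0 < r) (hr1 : r < 1)
    (hM : 0 < M) : Summable (fun k : ℕ => φ (M * r ^ k)) := by
  have hnn : ∀ t, 0 ≤ t → 0 ≤ φ t := fun t ht => by
    rw [← h0]; exact hm (Set.mem_Ici.2 le_rfl) ht ht
  obtain ⟨k0, hk0⟩ := exists_pow_lt_of_lt_one (one_div_pos.2 hM) hr1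
  rw [lt_div_iff₀ hM] at hk0
  rw [← summable_nat_add_iff (k0 + 1)]
  set s : ℕ → ℝ := fun k => M * r ^ (k0 + k) with hsdef
  have hspos : ∀ k, 0 < s k := fun k => by positivity
  have hsucc : ∀ k, s (k + 1) = r * s k := fun k => by simp only [hsdef]; ring
  have hs1 : ∀ k, s k ≤ 1 := by
    intro k
    induction k with
    | zero => simp only [hsdef]; simp; linarith
    | succ k ih => rw [hsucc]; nlinarith [hspos k]
  have hle : ∀ k, s (k + 1) ≤ s k := fun k => by rw [hsucc]; nlinarith [hspos k]
  have hint : ∀ a b, 0 ≤ a → 0 ≤ b → a ≤ 1 → b ≤ 1 → IntervalIntegrable (fun t => φ t / t) volume a b := by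
    intro a b ha hb ha1 hb1
    refine hi.mono_set ?_
    rw [Set.uIcc_of_le zero_le_one]
    exact Set.uIcc_subset_Icc ⟨ha, ha1⟩ ⟨hb, hb1⟩
  have hstep : ∀ k, φ (s (k + 1)) * (1 - r) ≤ ∫ t in (s (k+1))..(s k), φ t / t := by
    intro k
    have hc : ∫ t in (s (k+1))..(s k), φ (s (k+1)) / s k = φ (s (k + 1)) * (1 - r) := by
      rw [intervalIntegral.integral_const, hsucc, smul_eq_mul]
      have := (hspos k).ne'
      field_simp
    rw [← hc]
    refine intervalIntegral.integral_mono_on (hle k) intervalIntegrable_const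
      (hint _ _ (hspos _).le (hspos _).le (hs1 _) (hs1 _)) ?_
    intro t ht
    have ht0 : 0 < t := (hspos _).trans_le ht.1
    exact div_le_div₀ (hnn t ht0.le) (hm (hspos _).le ht0.le ht.1) ht0 ht.2
  have hsum : ∀ n, ∑ k ∈ Finset.range n, ∫ t in (s (k+1))..(s k), φ t / t ≤ ∫ t in (0:ℝ)..1, φ t / t := by
    intro n
    have e := intervalIntegral.sum_integral_adjacent_intervals (f := fun t => φ t / t) (μ := volume)
      (a := s) (n := n) (fun k _ => hint _ _ (hspos _).le (hspos _).le (hs1 _) (hs1 _))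
    have e2 : ∑ k ∈ Finset.range n, ∫ t in (s (k+1))..(s k), φ t / t = ∫ t in (s n)..(s 0), φ t / t := by
      rw [intervalIntegral.integral_symm, ← e, ← Finset.sum_neg_distrib]
      exact Finset.sum_congr rfl fun k _ => intervalIntegral.integral_symm _ _
    rw [e2]
    refine intervalIntegral.integral_mono_interval (hspos n).le
      (antitone_nat_of_succ_le hle (Nat.zero_le n)) (hs1 0) ?_ hi
    refine (ae_restrict_iff' measurableSet_Ioc).2 (Eventually.of_forall fun t ht => ?_)
    exact div_nonneg (hnn t ht.1.le) ht.1.le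
  have h1r : 0 < 1 - r := by linarith
  refine summable_of_sum_range_le (c := (∫ t in (0:ℝ)..1, φ t / t) / (1 - r))
    (fun n => hnn _ (by positivity)) fun n => ?_
  rw [le_div_iff₀ h1r, Finset.sum_mul]
  refine le_trans (Finset.sum_le_sum fun k _ => ?_) (hsum n)
  have : M * r ^ (k + (k0 + 1)) = s (k + 1) := by simp only [hsdef]; congr 2; ring
  rw [this]
  exact hstep k

lemma dini_continuous {X : Type*} [PseudoMetricSpace X] {p : X → ℝ} (h : DiniContinuous p) :
    Continuous p := by
  obtain ⟨φ, hm, h0, hi, hp⟩ := h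
  have hsum := (dini_summable φ hm h0 hi (1/2) 1 (by norm_num) (by norm_num) one_pos).tendsto_atTop_zero
  rw [Metric.continuous_iff]
  intro x ε hε
  obtain ⟨k, hk⟩ := (hsum.eventually (gt_mem_nhds hε)).exists
  refine ⟨1 * (1/2)^k, by positivity, fun y hy => ?_⟩
  rw [Real.dist_eq]
  refine (hp y x).trans_lt (lt_of_le_of_lt ?_ hk)
  exact hm (Set.mem_Ici.2 dist_nonneg) (Set.mem_Ici.2 (by positivity)) hy.le

lemma one_sided {L : ℕ} (u v s t : Fin L → ℝ) (hu : ∀ i, 0 ≤ u i) (hv : ∀ i, 0 ≤ v i)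
    (hus : ∑ i, u i = 1) (hvs : ∑ i, v i = 1) (a b q : ℝ) (ha : ∀ i, s i - t i ≤ a)
    (hb : ∀ i j, s i - t j ≤ b) (hab : a ≤ b) (hq : 1 - ∑ i, min (u i) (v i) ≤ q) :
    ∑ i, u i * s i - ∑ i, v i * t i ≤ (1 - q) * a + q * b := by
  have hne : Nonempty (Fin L) := by
    by_contra h
    rw [not_nonempty_iff] at h
    simp at hus
  obtain ⟨j0, hj0⟩ := Finite.exists_min t
  set e := 1 - ∑ i, min (u i) (v i) with he
  have h1 : ∑ i, min (u i) (v i) * (s i - t i) ≤ (1 - e) * a := by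
    have : (1 - e) * a = ∑ i, min (u i) (v i) * a := by rw [← Finset.sum_mul, he]; ring
    rw [this]
    exact Finset.sum_le_sum fun i _ => mul_le_mul_of_nonneg_left (ha i) (le_min (hu i) (hv i))
  have h2 : ∑ i, (u i - min (u i) (v i)) * s i ≤ e * (t j0 + b) := by
    have : e * (t j0 + b) = ∑ i, (u i - min (u i) (v i)) * (t j0 + b) := by
      rw [← Finset.sum_mul, he, Finset.sum_sub_distrib, hus]
    rw [this]
    refine Finset.sum_le_sum fun i _ => mul_le_mul_of_nonneg_left ?_ (sub_nonneg.2 (min_le_left _ _))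
    linarith [hb i j0]
  have h3 : e * t j0 ≤ ∑ i, (v i - min (u i) (v i)) * t i := by
    have : e * t j0 = ∑ i, (v i - min (u i) (v i)) * t j0 := by
      rw [← Finset.sum_mul, he, Finset.sum_sub_distrib, hvs]
    rw [this]
    exact Finset.sum_le_sum fun i _ => mul_le_mul_of_nonneg_left (hj0 i) (sub_nonneg.2 (min_le_right _ _))
  have h4 : ∑ i, u i * s i - ∑ i, v i * t i = ∑ i, min (u i) (v i) * (s i - t i)
      + ∑ i, (u i - min (u i) (v i)) * s i - ∑ i, (v i - min (u i) (v i)) * t i := by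
    rw [← Finset.sum_sub_distrib, ← Finset.sum_add_distrib, ← Finset.sum_sub_distrib]
    exact Finset.sum_congr rfl fun i _ => by ring
  rw [h4]
  nlinarith [mul_nonneg (sub_nonneg.2 hq) (sub_nonneg.2 hab)]

lemma two_sided {L : ℕ} (u v s t : Fin L → ℝ) (hu : ∀ i, 0 ≤ u i) (hv : ∀ i, 0 ≤ v i)
    (hus : ∑ i, u i = 1) (hvs : ∑ i, v i = 1) (a b q : ℝ) (ha : ∀ i, |s i - t i| ≤ a)
    (hb : ∀ i j, |s i - t j| ≤ b) (hab : a ≤ b) (hq : 1 - ∑ i, min (u i) (v i) ≤ q) :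
    |∑ i, u i * s i - ∑ i, v i * t i| ≤ (1 - q) * a + q * b := by
  rw [abs_le']
  constructor
  · exact one_sided u v s t hu hv hus hvs a b q (fun i => (abs_le'.1 (ha i)).1)
      (fun i j => (abs_le'.1 (hb i j)).1) hab hq
  · rw [neg_sub]
    refine one_sided v u t s hv hu hvs hus a b q (fun i => ?_) (fun i j => ?_) hab ?_
    · linarith [(abs_le'.1 (ha i)).2]
    · linarith [(abs_le'.1 (hb j i)).2]
    · simpa only [min_comm] using hq

/-- The dual (Koopman) operator of the kernel. -/
def Uop {X : Type*} {L : ℕ} (p : Fin L → X → ℝ) (W : Fin L → X → X) (g : X → ℝ) (x : X) : ℝ :=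
  ∑ ℓ, p ℓ x * g (W ℓ x)

lemma Uop_bound {X : Type*} {L : ℕ} {p : Fin L → X → ℝ} {W : Fin L → X → X}
    (hp : ∀ ℓ x, 0 ≤ p ℓ x) (hs : ∀ x, ∑ ℓ, p ℓ x = 1) {g : X → ℝ} {K : ℝ} (hg : ∀ x, |g x| ≤ K)
    (n : ℕ) : ∀ x, |(Uop p W)^[n] g x| ≤ K := by
  induction n with
  | zero => exact hg
  | succ n ih =>
    intro x
    rw [Function.iterate_succ_apply']
    calc _ ≤ ∑ ℓ, |p ℓ x * ((Uop p W)^[n] g) (W ℓ x)| := Finset.abs_sum_le_sum_abs _ _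
      _ ≤ ∑ ℓ, p ℓ x * K := Finset.sum_le_sum fun ℓ _ => by
          rw [abs_mul, abs_of_nonneg (hp ℓ x)]
          exact mul_le_mul_of_nonneg_left (ih _) (hp ℓ x)
      _ = K := by rw [← Finset.sum_mul, hs, one_mul]

lemma Uop_cont {X : Type*} [TopologicalSpace X] {L : ℕ} {p : Fin L → X → ℝ} {W : Fin L → X → X}
    (hp : ∀ ℓ, Continuous (p ℓ)) (hW : ∀ ℓ, Continuous (W ℓ)) {g : X → ℝ} (hg : Continuous g)
    (n : ℕ) : Continuous ((Uop p W)^[n] g) := by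
  induction n with
  | zero => exact hg
  | succ n ih =>
    rw [Function.iterate_succ_apply']
    unfold Uop at ih ⊢
    exact continuous_finsetSum _ fun ℓ _ => (hp ℓ).mul (ih.comp (hW ℓ))

lemma bind_eq {X : Type*} [MeasurableSpace X] {L : ℕ} {p : Fin L → X → ℝ} {W : Fin L → X → X}
    (hp : ∀ ℓ, Measurable (p ℓ)) (hW : ∀ ℓ, Measurable (W ℓ)) (ν : Measure X) :
    ν.bind (IFSKernel p W) =
      ∑ ℓ, (ν.withDensity (fun x => ENNReal.ofReal (p ℓ x))).map (W ℓ) := by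
  have hval : ∀ s, MeasurableSet s → ∀ x, IFSKernel p W x s =
      ∑ ℓ, (W ℓ ⁻¹' s).indicator (fun x => ENNReal.ofReal (p ℓ x)) x := by
    intro s hs x
    unfold IFSKernel
    rw [Measure.finsetSum_apply]
    refine Finset.sum_congr rfl fun ℓ _ => ?_
    rw [Measure.smul_apply, Measure.dirac_apply' _ hs]
    by_cases h : W ℓ x ∈ s <;> simp [Set.indicator, h]
  have hmeas : Measurable (IFSKernel p W) := by
    refine Measure.measurable_of_measurable_coe _ fun s hs => ?_
    simp only [hval s hs]
    exact Finset.measurable_sum _ fun ℓ _ => ((hp ℓ).ennreal_ofReal).indicator (hW ℓ hs)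
  ext s hs
  rw [Measure.bind_apply hs hmeas.aemeasurable, Measure.finsetSum_apply]
  simp only [hval s hs]
  rw [lintegral_finsetSum _ fun ℓ _ => ((hp ℓ).ennreal_ofReal).indicator (hW ℓ hs)]
  refine Finset.sum_congr rfl fun ℓ _ => ?_
  rw [Measure.map_apply (hW ℓ) hs, withDensity_apply _ (hW ℓ hs),
    lintegral_indicator (hW ℓ hs)]

section

variable {X : Type*} [TopologicalSpace X] [MeasurableSpace X] [BorelSpace X]
  {L : ℕ}
  {p : Fin L → X → ℝ} {W : Fin L → X → X}

lemma integrable_bc (ν : Measure X) [IsFiniteMeasure ν] {f : X → ℝ} (hf : Continuous f) {K : ℝ}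
    (hK : ∀ x, |f x| ≤ K) : Integrable f ν :=
  Integrable.of_bound (hf.measurable.aestronglyMeasurable) K (Eventually.of_forall hK)

lemma integral_bind' (hp : ∀ ℓ, Continuous (p ℓ)) (hW : ∀ ℓ, Continuous (W ℓ))
    (hp01 : ∀ ℓ x, p ℓ x ∈ Set.Icc (0 : ℝ) 1) (ν : Measure X)
    [IsProbabilityMeasure ν] {f : X → ℝ} (hf : Continuous f) {K : ℝ} (hK : ∀ x, |f x| ≤ K) :
    ∫ x, f x ∂(ν.bind (IFSKernel p W)) = ∫ x, Uop p W f x ∂ν := by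
  rw [bind_eq (fun ℓ => (hp ℓ).measurable) (fun ℓ => (hW ℓ).measurable)]
  have hfin : ∀ ℓ, IsFiniteMeasure (ν.withDensity (fun x => ENNReal.ofReal (p ℓ x))) := by
    intro ℓ
    refine isFiniteMeasure_withDensity (ne_top_of_le_ne_top (b := 1) ENNReal.one_ne_top ?_)
    calc _ ≤ ∫⁻ x, 1 ∂ν := lintegral_mono fun x => by
            rw [ENNReal.ofReal_le_one]; exact (hp01 ℓ x).2
      _ = 1 := by simp
  rw [integral_finsetSum_measure fun ℓ _ => integrable_bc _ hf hK]
  have hb : ∀ ℓ x, |p ℓ x * f (W ℓ x)| ≤ 1 * K := fun ℓ x => by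
    rw [abs_mul, abs_of_nonneg (hp01 ℓ x).1]
    exact mul_le_mul (hp01 ℓ x).2 (hK _) (abs_nonneg _) zero_le_one
  unfold Uop
  rw [integral_finsetSum _ fun ℓ _ => integrable_bc ν (f := fun x => p ℓ x * f (W ℓ x))
    ((hp ℓ).mul (hf.comp (hW ℓ))) (hb ℓ)]
  refine Finset.sum_congr rfl fun ℓ _ => ?_
  rw [integral_map (hW ℓ).measurable.aemeasurable hf.measurable.aestronglyMeasurable,
    integral_withDensity_eq_integral_toReal_smul (hp ℓ).measurable.ennreal_ofReal
      (Eventually.of_forall fun x => ENNReal.ofReal_lt_top)]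
  refine integral_congr_ae (Eventually.of_forall fun x => ?_)
  simp [ENNReal.toReal_ofReal (hp01 ℓ x).1]

lemma prob_bind (hp : ∀ ℓ, Continuous (p ℓ)) (hW : ∀ ℓ, Continuous (W ℓ))
    (hp01 : ∀ ℓ x, p ℓ x ∈ Set.Icc (0 : ℝ) 1) (hs : ∀ x, ∑ ℓ, p ℓ x = 1) (ν : Measure X)
    [IsProbabilityMeasure ν] : IsProbabilityMeasure (ν.bind (IFSKernel p W)) := by
  constructor
  rw [bind_eq (fun ℓ => (hp ℓ).measurable) (fun ℓ => (hW ℓ).measurable), Measure.finsetSum_apply]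
  have : ∀ ℓ, ((ν.withDensity (fun x => ENNReal.ofReal (p ℓ x))).map (W ℓ)) Set.univ
      = ∫⁻ x, ENNReal.ofReal (p ℓ x) ∂ν := fun ℓ => by
    rw [Measure.map_apply (hW ℓ).measurable MeasurableSet.univ]
    simp
  simp only [this]
  rw [← lintegral_finsetSum _ fun ℓ _ => (hp ℓ).measurable.ennreal_ofReal]
  have : ∀ x, ∑ ℓ, ENNReal.ofReal (p ℓ x) = 1 := fun x => by
    rw [← ENNReal.ofReal_sum_of_nonneg fun ℓ _ => (hp01 ℓ x).1, hs, ENNReal.ofReal_one]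
  simp [this]

lemma prob_iter (hp : ∀ ℓ, Continuous (p ℓ)) (hW : ∀ ℓ, Continuous (W ℓ))
    (hp01 : ∀ ℓ x, p ℓ x ∈ Set.Icc (0 : ℝ) 1) (hs : ∀ x, ∑ ℓ, p ℓ x = 1) (ν : Measure X)
    [IsProbabilityMeasure ν] (n : ℕ) :
    IsProbabilityMeasure ((fun m : Measure X => m.bind (IFSKernel p W))^[n] ν) := by
  induction n with
  | zero => assumption
  | succ n ih =>
    rw [Function.iterate_succ_apply']
    exact prob_bind hp hW hp01 hs _

lemma integral_iter (hp : ∀ ℓ, Continuous (p ℓ)) (hW : ∀ ℓ, Continuous (W ℓ))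
    (hp01 : ∀ ℓ x, p ℓ x ∈ Set.Icc (0 : ℝ) 1) (hs : ∀ x, ∑ ℓ, p ℓ x = 1) (ν : Measure X)
    [IsProbabilityMeasure ν] {f : X → ℝ} (hf : Continuous f) {K : ℝ} (hK : ∀ x, |f x| ≤ K)
    (n : ℕ) :
    ∫ x, f x ∂((fun m : Measure X => m.bind (IFSKernel p W))^[n] ν)
      = ∫ x, (Uop p W)^[n] f x ∂ν := by
  induction n generalizing f with
  | zero => rfl
  | succ n ih =>
    have := prob_iter hp hW hp01 hs ν n
    rw [Function.iterate_succ_apply', integral_bind' hp hW hp01 _ hf hK]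
    exact ih (f := Uop p W f) (Uop_cont hp hW hf 1) (Uop_bound (fun ℓ x => (hp01 ℓ x).1) hs hK 1)

end

section

variable {X : Type*} [NormedAddCommGroup X] [NormedSpace ℝ X]

/-- Vectors whose forward orbit under `T` decays at rate `M * r ^ (n + k)`. -/
def Eset (T : X →ₗ[ℝ] X) (M r : ℝ) (k : ℕ) : Set X := {v | ∀ n : ℕ, ‖T^[n] v‖ ≤ M * r ^ (n + k)}

lemma iter_add (T : X →ₗ[ℝ] X) (n : ℕ) (x y : X) : T^[n] (x + y) = T^[n] x + T^[n] y := by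
  induction n with
  | zero => rfl
  | succ n ih => simp only [Function.iterate_succ_apply', ih, map_add]

lemma iter_zero (T : X →ₗ[ℝ] X) (n : ℕ) : T^[n] 0 = 0 := by
  induction n with
  | zero => rfl
  | succ n ih => simp only [Function.iterate_succ_apply', ih, map_zero]

lemma Eset_add {T : X →ₗ[ℝ] X} {M r : ℝ} {v b : X} (hv : v ∈ Eset T M r 0)
    (hb : ∀ n : ℕ, ‖T^[n] b‖ ≤ M * (1 - r) * r ^ n) : T v + b ∈ Eset T M r 0 := by
  intro n
  rw [iter_add]
  refine (norm_add_le _ _).trans ?_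
  have h1 := hv (n + 1)
  rw [Function.iterate_succ_apply] at h1
  have h2 := hb n
  simp only [add_zero] at h1 ⊢
  rw [pow_succ] at h1
  linarith

lemma Eset_map {T : X →ₗ[ℝ] X} {M r : ℝ} {k : ℕ} {v : X} (hv : v ∈ Eset T M r k) :
    T v ∈ Eset T M r (k + 1) := by
  intro n
  have h1 := hv (n + 1)
  rw [Function.iterate_succ_apply] at h1
  rwa [show n + (k + 1) = n + 1 + k by ring]

lemma Eset_succ {T : X →ₗ[ℝ] X} {M r : ℝ} (hM : 0 ≤ M) (hr0 : 0 < r) (hr1 : r < 1) {k : ℕ} :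
    Eset T M r (k + 1) ⊆ Eset T M r k := by
  intro v hv n
  refine (hv n).trans (mul_le_mul_of_nonneg_left ?_ hM)
  exact pow_le_pow_of_le_one hr0.le hr1.le (by omega)

lemma Eset_zero_of_le {T : X →ₗ[ℝ] X} {M r : ℝ} (hM : 0 ≤ M) (hr0 : 0 < r) (hr1 : r < 1) {k : ℕ} :
    Eset T M r k ⊆ Eset T M r 0 := by
  induction k with
  | zero => exact subset_rfl
  | succ k ih => exact (Eset_succ hM hr0 hr1).trans ih

lemma contraction {L : ℕ} (T : X →ₗ[ℝ] X) {M r : ℝ} (hM : 0 < M) (hr0 : 0 < r) (hr1 : r < 1)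
    {β : Fin L → X} {W : Fin L → X → X} (hW : ∀ ℓ ξ, W ℓ ξ = T ξ + β ℓ)
    (hβ : ∀ ℓ m (n : ℕ), ‖T^[n] (β ℓ - β m)‖ ≤ M * (1 - r) * r ^ n)
    {p : Fin L → X → ℝ} (hp01 : ∀ ℓ x, p ℓ x ∈ Set.Icc (0 : ℝ) 1)
    (hpDini : ∀ ℓ, DiniContinuous (p ℓ)) (hpsum : ∀ x, ∑ ℓ, p ℓ x = 1)
    {δ : ℝ} (hδ : 0 < δ) (hplb : ∀ ℓ x, δ ≤ p ℓ x)
    {f : X → ℝ} {K : ℝ} (hK : ∀ x, |f x| ≤ K) {Lf : NNReal} (hL : LipschitzWith Lf f) :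
    ∃ ε : ℕ → ℝ, Tendsto ε atTop (𝓝 0) ∧ ∀ n x y, x - y ∈ Eset T M r 0 →
      |(Uop p W)^[n] f x - (Uop p W)^[n] f y| ≤ ε n := by
  have hp0 : ∀ ℓ x, 0 ≤ p ℓ x := fun ℓ x => (hp01 ℓ x).1
  have hne : Nonempty (Fin L) := by
    by_contra h
    rw [not_nonempty_iff] at h
    simpa using hpsum 0
  have hδ1 : δ ≤ 1 := (hplb hne.some 0).trans (hp01 _ _).2
  choose φ hφm hφ0 hφi hφ using hpDini
  have hφnn : ∀ ℓ t, 0 ≤ t → 0 ≤ φ ℓ t := fun ℓ t ht => by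
    rw [← hφ0 ℓ]; exact hφm ℓ (Set.mem_Ici.2 le_rfl) ht ht
  set q : ℕ → ℝ := fun k => min (∑ ℓ, φ ℓ (M * r ^ k)) (1 - δ) with hq
  set D : ℕ → X × X → ℝ := fun n z => |(Uop p W)^[n] f z.1 - (Uop p W)^[n] f z.2| with hD
  have hD2K : ∀ n z, D n z ≤ 2 * K := fun n z => by
    have h1 := Uop_bound (W := W) hp0 hpsum hK n z.1
    have h2 := Uop_bound (W := W) hp0 hpsum hK n z.2
    refine (abs_sub _ _).trans ?_
    linarith
  set w : ℕ → ℕ → ℝ := fun n k => ⨆ z : {z : X × X // z.1 - z.2 ∈ Eset T M r k}, D n z.1 with hw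
  have hbdd : ∀ n k, BddAbove (Set.range fun z : {z : X × X // z.1 - z.2 ∈ Eset T M r k} => D n z.1) := by
    intro n k
    refine ⟨2 * K, ?_⟩
    rintro _ ⟨z, rfl⟩
    exact hD2K n _
  have hnE : ∀ k, Nonempty {z : X × X // z.1 - z.2 ∈ Eset T M r k} := fun k =>
    ⟨⟨(0, 0), fun n => by
      simp only [sub_zero, iter_zero, norm_zero]; positivity⟩⟩
  have hle : ∀ n k x y, x - y ∈ Eset T M r k → |(Uop p W)^[n] f x - (Uop p W)^[n] f y| ≤ w n k := by
    intro n k x y h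
    exact le_ciSup (hbdd n k) ⟨(x, y), h⟩
  have hw0 : ∀ n k, 0 ≤ w n k := fun n k => Real.iSup_nonneg fun z => abs_nonneg _
  have hmono : ∀ n k, w n (k + 1) ≤ w n k := fun n k => by
    refine ciSup_le fun z => ?_
    exact hle n k _ _ (Eset_succ hM.le hr0 hr1 z.2)
  have hle0 : ∀ n k, w n k ≤ w n 0 := fun n k => by
    refine ciSup_le fun z => ?_
    exact hle n 0 _ _ (Eset_zero_of_le hM.le hr0 hr1 z.2)
  refine ⟨fun n => w n 0, ?_, fun n x y h => hle n 0 x y h⟩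
  have hqs : Summable (fun k : ℕ => ∑ ℓ, φ ℓ (M * r ^ k)) :=
    summable_sum fun ℓ _ => dini_summable (φ ℓ) (hφm ℓ) (hφ0 ℓ) (hφi ℓ) r M hr0 hr1 hM
  have hq0 : ∀ k, 0 ≤ q k := fun k =>
    le_min (Finset.sum_nonneg fun ℓ _ => hφnn ℓ _ (by positivity)) (by linarith)
  refine real_key w q (2 * K) hw0 (fun n k => ciSup_le fun z => hD2K n _) hmono hq0
    (fun k => lt_of_le_of_lt (min_le_right _ _) (by linarith))
    (Summable.of_nonneg_of_le hq0 (fun k => min_le_left _ _) hqs) ?_ ?_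
  · intro n k
    refine ciSup_le ?_
    rintro ⟨⟨x, y⟩, hz⟩
    simp only at hz
    simp only [hD]
    rw [Function.iterate_succ_apply']
    have hWW : ∀ ℓ m, W ℓ x - W m y = T (x - y) + (β ℓ - β m) := fun ℓ m => by
      rw [hW, hW, map_sub]; abel
    refine two_sided (fun ℓ => p ℓ x) (fun ℓ => p ℓ y) (fun ℓ => ((Uop p W)^[n] f) (W ℓ x))
      (fun ℓ => ((Uop p W)^[n] f) (W ℓ y)) (fun ℓ => hp0 ℓ x) (fun ℓ => hp0 ℓ y) (hpsum x) (hpsum y)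
      (w n (k + 1)) (w n 0) (q k) ?_ ?_ (hle0 n _) ?_
    · intro ℓ
      refine hle n _ _ _ ?_
      rw [hWW, sub_self, add_zero]
      exact Eset_map hz
    · intro ℓ m
      refine hle n _ _ _ ?_
      rw [hWW]
      exact Eset_add (Eset_zero_of_le hM.le hr0 hr1 hz) (hβ ℓ m)
    · refine le_min ?_ ?_
      · rw [← hpsum x, ← Finset.sum_sub_distrib]
        refine Finset.sum_le_sum fun ℓ _ => ?_
        have h1 := hφ ℓ x y
        have h2 : φ ℓ (dist x y) ≤ φ ℓ (M * r ^ k) := by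
          refine hφm ℓ (Set.mem_Ici.2 dist_nonneg) (Set.mem_Ici.2 (by positivity)) ?_
          have := hz 0
          rw [dist_eq_norm]
          simpa using this
        have h3 : p ℓ x - min (p ℓ x) (p ℓ y) ≤ |p ℓ x - p ℓ y| := by
          rcases min_cases (p ℓ x) (p ℓ y) with h | h <;> rw [h.1]
          · simp
          · exact le_abs_self _
        linarith
      · have : min (p hne.some x) (p hne.some y) ≤ ∑ ℓ, min (p ℓ x) (p ℓ y) :=
          Finset.single_le_sum (f := fun ℓ => min (p ℓ x) (p ℓ y))
            (fun ℓ _ => le_min (hp0 ℓ x) (hp0 ℓ y)) (Finset.mem_univ _)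
        have h2 : δ ≤ min (p hne.some x) (p hne.some y) := le_min (hplb _ _) (hplb _ _)
        linarith
  · have ht : Tendsto (fun k : ℕ => (Lf : ℝ) * (M * r ^ k)) atTop (𝓝 0) := by
      have := ((tendsto_pow_atTop_nhds_zero_of_lt_one hr0.le hr1).const_mul M).const_mul (Lf : ℝ)
      simpa using this
    refine squeeze_zero (hw0 0) (fun k => ciSup_le ?_) ht
    rintro ⟨⟨x, y⟩, hz⟩
    have h1 := hL.dist_le_mul x y
    rw [Real.dist_eq] at h1
    refine h1.trans (mul_le_mul_of_nonneg_left ?_ Lf.2)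
    have := hz 0
    rw [dist_eq_norm]
    simpa using this

theorem ifs_main [ProperSpace X] [MeasurableSpace X] [BorelSpace X] {L : ℕ}
    (T : X →ₗ[ℝ] X) (hT : Continuous T) {C r : ℝ} (hC : 0 ≤ C) (hr0 : 0 < r) (hr1 : r < 1)
    (hb : ∀ n x, ‖T^[n] x‖ ≤ C * r ^ n * ‖x‖)
    {β : Fin L → X} {W : Fin L → X → X} (hW : ∀ ℓ ξ, W ℓ ξ = T ξ + β ℓ)
    {p : Fin L → X → ℝ} (hp01 : ∀ ℓ x, p ℓ x ∈ Set.Icc (0 : ℝ) 1)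
    (hpDini : ∀ ℓ, DiniContinuous (p ℓ)) (hpsum : ∀ x, ∑ ℓ, p ℓ x = 1)
    {δ : ℝ} (hδ : 0 < δ) (hplb : ∀ ℓ x, δ ≤ p ℓ x) :
    ∃ μstar : Measure X,
      (IsProbabilityMeasure μstar ∧ Invariant (IFSKernel p W) μstar) ∧
      (∀ μ : Measure X,
        IsProbabilityMeasure μ → Invariant (IFSKernel p W) μ → μ = μstar) ∧
      Attractive (IFSKernel p W) μstar := by
  have hp : ∀ ℓ, Continuous (p ℓ) := fun ℓ => dini_continuous (hpDini ℓ)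
  have hWc : ∀ ℓ, Continuous (W ℓ) := fun ℓ => by
    have : W ℓ = fun ξ => T ξ + β ℓ := funext (hW ℓ)
    rw [this]; exact hT.add continuous_const
  have hTn : ∀ n : ℕ, Continuous (T^[n]) := fun n => hT.iterate n
  have h1r : 0 < 1 - r := by linarith
  have hp0 : ∀ ℓ x, 0 ≤ p ℓ x := fun ℓ x => (hp01 ℓ x).1
  set B : ℝ := ∑ ℓ, ‖β ℓ‖ with hB
  have hB0 : 0 ≤ B := Finset.sum_nonneg fun ℓ _ => norm_nonneg _
  have hβB : ∀ ℓ, ‖β ℓ‖ ≤ B := fun ℓ =>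
    Finset.single_le_sum (f := fun ℓ => ‖β ℓ‖) (fun _ _ => norm_nonneg _) (Finset.mem_univ ℓ)
  set M0 : ℝ := 2 * C * B / (1 - r) + 1 with hM0
  have hM0pos : 0 < M0 := by positivity
  have hM0' : 2 * C * B ≤ M0 * (1 - r) := by
    rw [hM0, add_mul, div_mul_cancel₀ _ h1r.ne']; linarith
  -- contraction for arbitrary pairs
  have hβ : ∀ M, M0 ≤ M → ∀ ℓ m (n : ℕ), ‖T^[n] (β ℓ - β m)‖ ≤ M * (1 - r) * r ^ n := by
    intro M hM ℓ m n
    refine (hb n _).trans ?_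
    have h1 : ‖β ℓ - β m‖ ≤ 2 * B := (norm_sub_le _ _).trans (by linarith [hβB ℓ, hβB m])
    have h2 : C * (2 * B) ≤ M * (1 - r) := by nlinarith
    have h3 : 0 < r ^ n := by positivity
    calc C * r ^ n * ‖β ℓ - β m‖ ≤ C * r ^ n * (2 * B) := by gcongr
      _ = C * (2 * B) * r ^ n := by ring
      _ ≤ _ := by gcongr
  have hβ1 : ∀ ℓ (n : ℕ), ‖T^[n] (β ℓ)‖ ≤ M0 * (1 - r) * r ^ n := by
    intro ℓ n
    refine (hb n _).trans ?_
    have h2 : C * B ≤ M0 * (1 - r) := by nlinarith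
    calc C * r ^ n * ‖β ℓ‖ ≤ C * r ^ n * B := by gcongr; exact hβB ℓ
      _ = C * B * r ^ n := by ring
      _ ≤ _ := by gcongr
  set G := Eset T M0 r 0 with hG
  have hG0 : (0 : X) ∈ G := fun n => by rw [iter_zero, norm_zero]; positivity
  have hGW : ∀ ℓ x, x ∈ G → W ℓ x ∈ G := fun ℓ x hx => by
    rw [hW]; exact Eset_add hx (hβ1 ℓ)
  have hGclosed : IsClosed G := by
    have : G = ⋂ n : ℕ, {v | ‖T^[n] v‖ ≤ M0 * r ^ (n + 0)} := by
      ext v; simp [hG, Eset]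
    rw [this]
    exact isClosed_iInter fun n => isClosed_le (hTn n).norm continuous_const
  have hGcomp : IsCompact G := by
    refine (isCompact_closedBall (0 : X) M0).of_isClosed_subset hGclosed fun v hv => ?_
    have := hv 0
    simpa using this
  set F : Measure X → Measure X := fun m : Measure X => m.bind (IFSKernel p W) with hF
  set ν0 : Measure X := Measure.dirac 0 with hν0
  have hprob : ∀ n, IsProbabilityMeasure (F^[n] ν0) := fun n => prob_iter hp hWc hp01 hpsum ν0 n
  have hsupp : ∀ n, (F^[n] ν0) Gᶜ = 0 := by
    intro n
    induction n with
    | zero =>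
      rw [Function.iterate_zero_apply, hν0, Measure.dirac_apply' _ hGclosed.measurableSet.compl]
      simp [hG0]
    | succ n ih =>
      rw [Function.iterate_succ_apply', hF]
      simp only
      rw [bind_eq (fun ℓ => (hp ℓ).measurable) (fun ℓ => (hWc ℓ).measurable), Measure.finsetSum_apply]
      refine Finset.sum_eq_zero fun ℓ _ => ?_
      rw [Measure.map_apply (hWc ℓ).measurable hGclosed.measurableSet.compl]
      refine withDensity_absolutelyContinuous _ _ (measure_mono_null ?_ ih)
      intro x hx hxG
      exact hx (hGW ℓ x hxG)
  let νs : ℕ → ProbabilityMeasure X := fun n => ⟨F^[n] ν0, hprob n⟩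
  have hcompact : IsCompact (closure (Set.range νs)) := by
    apply isCompact_closure_of_isTightMeasureSet
    rw [isTightMeasureSet_iff_exists_isCompact_measure_compl_le]
    intro ε hε
    refine ⟨G, hGcomp, ?_⟩
    rintro _ ⟨_, ⟨n, rfl⟩, rfl⟩
    exact (hsupp n).le.trans zero_le
  obtain ⟨μ, -, hμ⟩ := hcompact.ultrafilter_le_nhds' ((hyperfilter ℕ).map νs)
    (by
      rw [Ultrafilter.mem_map]
      exact Filter.mem_of_superset Filter.univ_mem fun n _ => subset_closure ⟨n, rfl⟩)
  have hμt : Tendsto νs (hyperfilter ℕ : Filter ℕ) (𝓝 μ) := hμ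
  have hhyp : (hyperfilter ℕ : Filter ℕ) ≤ atTop := by
    rw [← Nat.cofinite_eq_atTop]; exact hyperfilter_le_cofinite
  have hattr : Attractive (IFSKernel p W) (μ : Measure X) := by
    intro ν hν
    let ρ : ℕ → ProbabilityMeasure X := fun n => ⟨F^[n] ν, prob_iter hp hWc hp01 hpsum ν n⟩
    have key : Tendsto ρ atTop (𝓝 μ) := by
      rw [tendsto_iff_forall_lipschitz_integral_tendsto]
      rintro f ⟨c, hc⟩ ⟨Lf, hL⟩
      have hK : ∀ x, |f x| ≤ |f 0| + c := fun x => by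
        have h1 := hc x 0
        rw [Real.dist_eq] at h1
        have h2 := abs_sub_abs_le_abs_sub (f x) (f 0)
        linarith
      have hfc := hL.continuous
      have hUc := fun n => Uop_cont hp hWc hfc n
      have hUb := fun n => Uop_bound (W := W) hp0 hpsum hK n
      have hint : ∀ n, ∫ x, f x ∂(F^[n] ν0) = (Uop p W)^[n] f 0 := fun n => by
        rw [integral_iter hp hWc hp01 hpsum ν0 hfc hK n, hν0, integral_dirac]
      obtain ⟨ε, hε0, hε⟩ := contraction T hM0pos hr0 hr1 hW (hβ M0 le_rfl) hp01 hpDini hpsum hδ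
        hplb hK hL
      have hcau : CauchySeq (fun n => (Uop p W)^[n] f 0) := by
        refine cauchySeq_of_le_tendsto_0' ε (fun n m hnm => ?_) hε0
        obtain ⟨k, rfl⟩ := Nat.exists_eq_add_of_le hnm
        have h1 : (Uop p W)^[n + k] f 0 = ∫ x, (Uop p W)^[n] f x ∂(F^[k] ν0) := by
          have := hprob k
          rw [← hint, Function.iterate_add_apply, integral_iter hp hWc hp01 hpsum _ hfc hK n]
        have := hprob k
        have h2 : ∫ x, ((Uop p W)^[n] f x - (Uop p W)^[n] f 0) ∂(F^[k] ν0)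
            = (Uop p W)^[n + k] f 0 - (Uop p W)^[n] f 0 := by
          rw [integral_sub (integrable_bc _ (hUc n) (hUb n)) (integrable_const _), ← h1]
          simp
        rw [dist_comm, Real.dist_eq, ← h2, ← Real.norm_eq_abs]
        have h3 := norm_integral_le_of_norm_le_const (μ := F^[k] ν0)
          (f := fun x => (Uop p W)^[n] f x - (Uop p W)^[n] f 0) (C := ε n) (by
            have : ∀ᵐ x ∂(F^[k] ν0), x ∈ G := by
              rw [ae_iff]; exact hsupp k
            filter_upwards [this] with x hx
            rw [Real.norm_eq_abs]
            exact hε n x 0 (by rwa [sub_zero]))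
        simpa using h3
      obtain ⟨l, hl⟩ := cauchySeq_tendsto_of_complete hcau
      have hlμ : l = ∫ x, f x ∂(μ : Measure X) := by
        have h1 := (ProbabilityMeasure.tendsto_iff_forall_integral_tendsto.1 hμt)
          (BoundedContinuousFunction.ofNormedAddCommGroup f hfc (|f 0| + c) hK)
        have h2 : Tendsto (fun n => (Uop p W)^[n] f 0) (hyperfilter ℕ : Filter ℕ)
            (𝓝 (∫ x, f x ∂(μ : Measure X))) := by
          refine h1.congr fun n => ?_
          exact hint n
        exact tendsto_nhds_unique (hl.mono_left hhyp) h2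
      have hpt : ∀ x, Tendsto (fun n => (Uop p W)^[n] f x) atTop (𝓝 l) := by
        intro x
        have hM : M0 ≤ M0 + C * ‖x‖ := by
          have : 0 ≤ C * ‖x‖ := by positivity
          linarith
        obtain ⟨η, hη0, hη⟩ := contraction T (hM0pos.trans_le hM) hr0 hr1 hW (hβ _ hM) hp01 hpDini
          hpsum hδ hplb hK hL
        have h1 : Tendsto (fun n => (Uop p W)^[n] f x - (Uop p W)^[n] f 0) atTop (𝓝 0) := by
          refine squeeze_zero_norm (fun n => ?_) hη0
          rw [Real.norm_eq_abs]
          refine hη n x 0 fun j => ?_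
          rw [sub_zero, add_zero]
          refine (hb j x).trans ?_
          have : 0 < r ^ j := by positivity
          nlinarith
        have h2 := h1.add hl
        simpa using h2
      rw [← hlμ]
      have hfin : ∀ n, ∫ x, f x ∂((ρ n : ProbabilityMeasure X) : Measure X) = ∫ x, (Uop p W)^[n] f x ∂ν :=
        fun n => integral_iter hp hWc hp01 hpsum ν hfc hK n
      simp only [hfin]
      have hlc : l = ∫ x, l ∂ν := by simp
      rw [hlc]
      refine tendsto_integral_of_dominated_convergence (fun _ => |f 0| + c)
        (fun n => (hUc n).measurable.aestronglyMeasurable) (integrable_const _)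
        (fun n => Eventually.of_forall fun x => hUb n x) (Eventually.of_forall hpt)
    intro f
    exact (ProbabilityMeasure.tendsto_iff_forall_integral_tendsto.1 key) f
  have hbK : ∀ f : BoundedContinuousFunction X ℝ, ∀ x, |f x| ≤ ‖f‖ := fun f x => f.norm_coe_le_norm x
  refine ⟨μ, ⟨inferInstance, ?_⟩, ?_, hattr⟩
  · have := prob_bind hp hWc hp01 hpsum (μ : Measure X)
    refine ext_of_forall_integral_eq_of_IsFiniteMeasure fun f => ?_
    rw [integral_bind' hp hWc hp01 _ f.continuous (hbK f)]
    have h1 := hattr ν0 inferInstance f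
    have h2 := hattr ν0 inferInstance (BoundedContinuousFunction.ofNormedAddCommGroup (Uop p W f)
      (Uop_cont hp hWc f.continuous 1) ‖f‖ (Uop_bound hp0 hpsum (hbK f) 1))
    refine tendsto_nhds_unique h2 ?_
    refine ((tendsto_add_atTop_iff_nat 1).2 h1).congr fun n => ?_
    have := hprob n
    rw [Function.iterate_succ_apply']
    exact integral_bind' hp hWc hp01 (F^[n] ν0) f.continuous (hbK f)
  · intro ν hν hinv
    refine ext_of_forall_integral_eq_of_IsFiniteMeasure fun f => ?_
    have h1 := hattr ν hν f
    have h2 : ∀ n, F^[n] ν = ν := fun n => Function.iterate_fixed (show F ν = ν from hinv) n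
    simp only [hF] at h2
    simp only [h2] at h1
    exact tendsto_nhds_unique tendsto_const_nhds h1

end

/-- Theorem 1: interconnection of two ensembles with affine agents, stable linear controllers
and filters.  The augmented matrix `𝒜` is block lower triangular with diagonal blocks the
block diagonal matrices of the Schur agent matrices `A₁ i`, `A₂ i`, the Schur filter matrices
`Af₁, Af₂` and the Schur controller matrices `Ac₁, Ac₂`; the affine maps `W ℓ ξ = 𝒜 ξ + β ℓ`
are chosen with Dini continuous probabilities bounded below by `δ > 0`.  Then the associated
Markov kernel has a unique invariant Borel probability measure, which is attractive. -/
theorem two_ensemble_affine_unique_attractive_invariant_measure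
    {N₁ N₂ : ℕ} {n₁ : Fin N₁ → ℕ} {n₂ : Fin N₂ → ℕ} {d₃ d₄ d₅ d₆ : ℕ}
    (A₁ : ∀ i : Fin N₁, Matrix (Fin (n₁ i)) (Fin (n₁ i)) ℝ)
    (A₂ : ∀ i : Fin N₂, Matrix (Fin (n₂ i)) (Fin (n₂ i)) ℝ)
    (Af₁ : Matrix (Fin d₃) (Fin d₃) ℝ) (Af₂ : Matrix (Fin d₄) (Fin d₄) ℝ)
    (Ac₁ : Matrix (Fin d₅) (Fin d₅) ℝ) (Ac₂ : Matrix (Fin d₆) (Fin d₆) ℝ)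
    (hA₁ : ∀ i, IsSchur (A₁ i)) (hA₂ : ∀ i, IsSchur (A₂ i))
    (hAf₁ : IsSchur Af₁) (hAf₂ : IsSchur Af₂) (hAc₁ : IsSchur Ac₁) (hAc₂ : IsSchur Ac₂)
    (𝒜 : Matrix (Idx6 N₁ N₂ n₁ n₂ d₃ d₄ d₅ d₆) (Idx6 N₁ N₂ n₁ n₂ d₃ d₄ d₅ d₆) ℝ)
    (hlower : ∀ i j, blk6 i < blk6 j → 𝒜 i j = 0)
    (hD₁ : ∀ a b, 𝒜 (Sum.inl a) (Sum.inl b) = Matrix.blockDiagonal' A₁ a b)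
    (hD₂ : ∀ a b, 𝒜 (Sum.inr (Sum.inl a)) (Sum.inr (Sum.inl b)) = Matrix.blockDiagonal' A₂ a b)
    (hD₃ : ∀ a b, 𝒜 (Sum.inr (Sum.inr (Sum.inl a))) (Sum.inr (Sum.inr (Sum.inl b))) = Af₁ a b)
    (hD₄ : ∀ a b, 𝒜 (Sum.inr (Sum.inr (Sum.inr (Sum.inl a))))
      (Sum.inr (Sum.inr (Sum.inr (Sum.inl b)))) = Af₂ a b)
    (hD₅ : ∀ a b, 𝒜 (Sum.inr (Sum.inr (Sum.inr (Sum.inr (Sum.inl a)))))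
      (Sum.inr (Sum.inr (Sum.inr (Sum.inr (Sum.inl b))))) = Ac₁ a b)
    (hD₆ : ∀ a b, 𝒜 (Sum.inr (Sum.inr (Sum.inr (Sum.inr (Sum.inr a)))))
      (Sum.inr (Sum.inr (Sum.inr (Sum.inr (Sum.inr b))))) = Ac₂ a b)
    {L : ℕ} (β : Fin L → EuclideanSpace ℝ (Idx6 N₁ N₂ n₁ n₂ d₃ d₄ d₅ d₆))
    (W : Fin L → EuclideanSpace ℝ (Idx6 N₁ N₂ n₁ n₂ d₃ d₄ d₅ d₆) →
      EuclideanSpace ℝ (Idx6 N₁ N₂ n₁ n₂ d₃ d₄ d₅ d₆))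
    (hW : ∀ ℓ ξ, W ℓ ξ = Matrix.toEuclideanLin 𝒜 ξ + β ℓ)
    (p : Fin L → EuclideanSpace ℝ (Idx6 N₁ N₂ n₁ n₂ d₃ d₄ d₅ d₆) → ℝ)
    (hp01 : ∀ ℓ x, p ℓ x ∈ Set.Icc (0 : ℝ) 1)
    (hpDini : ∀ ℓ, DiniContinuous (p ℓ))
    (hpsum : ∀ x, ∑ ℓ, p ℓ x = 1)
    (δ : ℝ) (hδ : 0 < δ) (hplb : ∀ ℓ x, δ ≤ p ℓ x) :
    ∃ μstar : Measure (EuclideanSpace ℝ (Idx6 N₁ N₂ n₁ n₂ d₃ d₄ d₅ d₆)),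
      (IsProbabilityMeasure μstar ∧ Invariant (IFSKernel p W) μstar) ∧
      (∀ μ : Measure (EuclideanSpace ℝ (Idx6 N₁ N₂ n₁ n₂ d₃ d₄ d₅ d₆)),
        IsProbabilityMeasure μ → Invariant (IFSKernel p W) μ → μ = μstar) ∧
      Attractive (IFSKernel p W) μstar := by
  have hS : IsSchur 𝒜 := by
    refine schur_fromBlocks 𝒜 (fun i j => hlower _ _ (by rcases j with j | j | j | j | j <;> simp [blk6])) ?_ ?_
    · have : 𝒜.toBlocks₁₁ = Matrix.blockDiagonal' A₁ := by ext a b; exact hD₁ a b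
      rw [this]; exact schur_blockDiagonal A₁ hA₁
    refine schur_fromBlocks _ (fun i j => hlower _ _ (by rcases j with j | j | j | j <;> simp [blk6])) ?_ ?_
    · convert schur_blockDiagonal A₂ hA₂ using 1
      ext a b; exact hD₂ a b
    refine schur_fromBlocks _ (fun i j => hlower _ _ (by rcases j with j | j | j <;> simp [blk6])) ?_ ?_
    · convert hAf₁ using 1
      ext a b; exact hD₃ a b
    refine schur_fromBlocks _ (fun i j => hlower _ _ (by rcases j with j | j <;> simp [blk6])) ?_ ?_
    · convert hAf₂ using 1
      ext a b; exact hD₄ a b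
    refine schur_fromBlocks _ (fun i j => hlower _ _ (by simp [blk6])) ?_ ?_
    · convert hAc₁ using 1
      ext a b; exact hD₅ a b
    · convert hAc₂ using 1
      ext a b; exact hD₆ a b
  obtain ⟨C, r, hC, hr0, hr1, hb⟩ := schur_clm_bound 𝒜 hS
  exact ifs_main (Matrix.toEuclideanLin 𝒜) (LinearMap.continuous_of_finiteDimensional _) hC hr0 hr1
    hb hW hp01 hpDini hpsum hδ hplb
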